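/- arXiv:2110.05716 — 2 statements merged into one kernel-verified Lean document; each statement's English description precedes it below -/
import Mathlib

section
/- Under Assumption 2.1, the semi-tamed Milstein scheme satisfies the following deterministic one-step exponential bound: for any n ∈ {0,…,N−1}, if 1 ≤ ‖Y_n‖ ≤ N^{1/(2c)} and ‖ΔW_n‖ ≤ 1, then ‖Y_{n+1}‖² ≤ ‖Y_n‖²·exp(2λ/N + 2λ‖ΔW_n‖² + 2α_n). (Inequality (2.21) in the proof of Lemma 2.1.) -/
open MeasureTheory ProbabilityTheory Real Finset
open scoped RealInnerProductSpace ENNReal NNReal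

noncomputable section

abbrev Vec (n : ℕ) : Type := EuclideanSpace ℝ (Fin n)

/-- The `d × m` matrix with columns `g j x`, viewed as a continuous linear map `ℝ^m → ℝ^d`. -/
def Gclm {d m : ℕ} (g : Fin m → Vec d → Vec d) (x : Vec d) : Vec m →L[ℝ] Vec d :=
  LinearMap.toContinuousLinearMap
  { toFun := fun w => ∑ j, w j • g j x
    map_add' := by
      intro w w'
      simp [PiLp.add_apply, add_smul, Finset.sum_add_distrib]
    map_smul' := by
      intro c w
      simp [PiLp.smul_apply, smul_smul, Finset.smul_sum] }

/-- `L^{j₁} g_{j₂} (x) = (Dg_{j₂})(x) · g_{j₁}(x)`. -/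
def Lg {d m : ℕ} (g : Fin m → Vec d → Vec d) (j₁ j₂ : Fin m) (x : Vec d) : Vec d :=
  fderiv ℝ (g j₂) x (g j₁ x)

/-- One step of the semi-tamed Milstein scheme with stepsize `h`, drift parts `ph` (Lipschitz)
and `ps` (tamed), diffusion columns `g`, current state `y` and Brownian increment `w`. -/
def milstep {d m : ℕ} (h : ℝ) (ph ps : Vec d → Vec d) (g : Fin m → Vec d → Vec d)
    (y : Vec d) (w : Vec m) : Vec d :=
  y + h • ph y + (h / (1 + ‖ps y‖ * h)) • ps y + Gclm g y w
    + (2⁻¹ : ℝ) • ∑ j₁, ∑ j₂, (w j₁ * w j₂ - (if j₁ = j₂ then h else 0)) • Lg g j₁ j₂ y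

/-- The quantity `α` associated with a state `y` and an increment `w`. -/
def alph {d m : ℕ} (h : ℝ) (g : Fin m → Vec d → Vec d) (y : Vec d) (w : Vec m) : ℝ :=
  if 1 ≤ ‖y‖ then
    ⟪‖y‖⁻¹ • y, ‖y‖⁻¹ • (Gclm g y w)⟫
      + ⟪‖y‖⁻¹ • y,
          (2 * ‖y‖)⁻¹ • ∑ j₁, ∑ j₂, (w j₁ * w j₂ - (if j₁ = j₂ then h else 0)) • Lg g j₁ j₂ y⟫
  else 0

/-- The constant `λ`. -/
def lamc {d m : ℕ} (T K : ℝ) (ph ps : Vec d → Vec d) (g : Fin m → Vec d → Vec d) : ℝ :=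
  (1 + 4 * T * K + 2 * T * (‖ph 0‖ + ‖ps 0‖) + 2 * K + 2 * ‖Gclm g 0‖
    + (m : ℝ) ^ 2 * (T + 1) * (K + ⨆ j : Fin m × Fin m, ‖Lg g j.1 j.2 0‖)) ^ 2

/-- The dominating process `D_n`, given `λ`, `‖ξ‖`, the squared increment norms and the `α`'s. -/
def Dproc (lam ξnorm : ℝ) (w2 al : ℕ → ℝ) (n : ℕ) : ℝ :=
  (lam + ξnorm) * Real.exp (lam +
    (Finset.range (n + 1)).sup' Finset.nonempty_range_add_one
      (fun u => ∑ k ∈ Finset.Ico u n, (lam * w2 k + al k)))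

end

noncomputable section

/-- Linear growth with slope `K r ^ c` on the ball of radius `r`, for a map whose derivative grows
at most like `K ‖x‖ ^ c`. -/
lemma norm_le_of_fderiv_growth {d : ℕ} {ps : Vec d → Vec d} {K c : ℝ} (hK : 0 ≤ K) (hc : 0 ≤ c)
    (hpsC : ContDiff ℝ 1 ps) (hps' : ∀ x : Vec d, ‖fderiv ℝ ps x‖ ≤ K * ‖x‖ ^ c) (y : Vec d) :
    ‖ps y‖ ≤ ‖ps 0‖ + K * ‖y‖ ^ c * ‖y‖ := by
  have hmv : ‖ps y - ps 0‖ ≤ K * ‖y‖ ^ c * ‖y - 0‖ := by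
    refine (convex_closedBall (0 : Vec d) ‖y‖).norm_image_sub_le_of_norm_fderiv_le (𝕜 := ℝ)
      (fun x _ => (hpsC.differentiable one_ne_zero) x) (fun x hx => ?_) (by simp) (by simp)
    have hx' : ‖x‖ ≤ ‖y‖ := by simpa using hx
    exact (hps' x).trans (by gcongr)
  rw [sub_zero] at hmv
  linarith [norm_le_norm_add_norm_sub' (ps y) (ps 0)]

/-- Linear growth of a Lipschitz map outside the unit ball. -/
lemma norm_le_mul_of_lipschitz {E F : Type*} [NormedAddCommGroup E] [NormedAddCommGroup F]
    {f : E → F} {K b : ℝ} (hf : ∀ x y, ‖f x - f y‖ ≤ K * ‖x - y‖) (hb : ‖f 0‖ ≤ b)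
    {y : E} (hy : 1 ≤ ‖y‖) : ‖f y‖ ≤ (b + K) * ‖y‖ := by
  have hlip := hf y 0
  rw [sub_zero] at hlip
  have hb0 : 0 ≤ b := (norm_nonneg _).trans hb
  nlinarith [norm_le_norm_add_norm_sub' (f y) (f 0), mul_le_mul_of_nonneg_left hy hb0]

/-- Bound on the Milstein correction term. -/
lemma norm_milstein_correction_le {d m : ℕ} {h B : ℝ} (hh : 0 ≤ h) (w : Vec m)
    (v : Fin m → Fin m → Vec d) (hv : ∀ j₁ j₂, ‖v j₁ j₂‖ ≤ B) :
    ‖∑ j₁, ∑ j₂, (w j₁ * w j₂ - (if j₁ = j₂ then h else 0)) • v j₁ j₂‖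
      ≤ (m : ℝ) ^ 2 * ((‖w‖ ^ 2 + h) * B) := by
  have hterm : ∀ j₁ j₂, ‖(w j₁ * w j₂ - (if j₁ = j₂ then h else 0)) • v j₁ j₂‖
      ≤ (‖w‖ ^ 2 + h) * B := by
    intro j₁ j₂
    rw [norm_smul]
    refine mul_le_mul ?_ (hv j₁ j₂) (norm_nonneg _) (by positivity)
    refine (norm_sub_le _ _).trans (add_le_add ?_ ?_)
    · rw [norm_mul, sq]
      exact mul_le_mul (PiLp.norm_apply_le w j₁) (PiLp.norm_apply_le w j₂) (norm_nonneg _)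
        (norm_nonneg _)
    · split_ifs <;> simp [abs_of_nonneg hh, hh]
  calc ‖∑ j₁, ∑ j₂, (w j₁ * w j₂ - (if j₁ = j₂ then h else 0)) • v j₁ j₂‖
      ≤ ∑ _j₁ : Fin m, ∑ _j₂ : Fin m, (‖w‖ ^ 2 + h) * B :=
        norm_sum_le_of_le _ fun j₁ _ => norm_sum_le_of_le _ fun j₂ _ => hterm j₁ j₂
    _ = (m : ℝ) ^ 2 * ((‖w‖ ^ 2 + h) * B) := by
        simp only [sum_const, card_univ, Fintype.card_fin, nsmul_eq_mul]
        ring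

/-- One-sided bound on the semi-tamed drift, with taming factor `t ∈ [0, 1]`. -/
lemma inner_tamed_drift_le {E : Type*} [NormedAddCommGroup E] [InnerProductSpace ℝ E]
    {y u v u₀ v₀ : E} {K t : ℝ} (hy : 1 ≤ ‖y‖) (ht₀ : 0 ≤ t) (ht₁ : t ≤ 1)
    (hmono : ⟪y, (u + v) - (u₀ + v₀)⟫ ≤ K * ‖y‖ ^ 2) (hu : ‖u‖ ≤ (‖u₀‖ + K) * ‖y‖) :
    ⟪y, u⟫ + t * ⟪y, v⟫ ≤ (K + ‖u₀‖ + ‖v₀‖) * ‖y‖ ^ 2 := by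
  have hsum : ⟪y, u⟫ + ⟪y, v⟫ ≤ (K + ‖u₀‖ + ‖v₀‖) * ‖y‖ ^ 2 := by
    rw [inner_sub_right, inner_add_right, inner_add_right] at hmono
    have hu₀ := real_inner_le_norm y u₀
    have hv₀ := real_inner_le_norm y v₀
    have hr : ‖y‖ ≤ ‖y‖ ^ 2 := by nlinarith
    nlinarith [mul_le_mul_of_nonneg_right hr (norm_nonneg u₀),
      mul_le_mul_of_nonneg_right hr (norm_nonneg v₀)]
  have hlip : ⟪y, u⟫ ≤ (K + ‖u₀‖ + ‖v₀‖) * ‖y‖ ^ 2 := by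
    have := real_inner_le_norm y u
    nlinarith [mul_le_mul_of_nonneg_left hu (norm_nonneg y),
      mul_nonneg (norm_nonneg v₀) (sq_nonneg ‖y‖)]
  nlinarith [mul_le_mul_of_nonneg_left hsum ht₀,
    mul_le_mul_of_nonneg_left hlip (sub_nonneg.2 ht₁)]

set_option maxHeartbeats 400000 in
/-- Inequality (2.21): deterministic one-step exponential bound. -/
theorem semiTamedMilstein_one_step_exp_bound
    (d m N : ℕ) (hd : 0 < d) (hm : 0 < m) (hN : 0 < N)
    (T : ℝ) (hT : 0 < T)
    (ph ps : Vec d → Vec d) (g : Fin m → Vec d → Vec d)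
    (K c : ℝ) (hK : 1 ≤ K) (hc : 1 ≤ c)
    (hgdiff : ∀ j, ContDiff ℝ 1 (g j))
    (hOSL : ∀ x y : Vec d, ⟪x - y, (ph x + ps x) - (ph y + ps y)⟫ ≤ K * ‖x - y‖ ^ 2)
    (hgLip : ∀ x y : Vec d, ‖Gclm g x - Gclm g y‖ ≤ K * ‖x - y‖)
    (hphLip : ∀ x y : Vec d, ‖ph x - ph y‖ ≤ K * ‖x - y‖)
    (hpsC : ContDiff ℝ 1 ps)
    (hps' : ∀ x : Vec d, ‖fderiv ℝ ps x‖ ≤ K * ‖x‖ ^ c)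
    (hLgLip : ∀ (j₁ j₂ : Fin m) (x y : Vec d), ‖Lg g j₁ j₂ x - Lg g j₁ j₂ y‖ ≤ K * ‖x - y‖)
    (ξ : Vec d) (ΔW : ℕ → Vec m)
    (Y : ℕ → Vec d) (hY0 : Y 0 = ξ)
    (hYrec : ∀ n, Y (n + 1) = milstep (T / N) ph ps g (Y n) (ΔW n))
    (n : ℕ) (hn : n < N)
    (hYlow : 1 ≤ ‖Y n‖) (hYhigh : ‖Y n‖ ≤ (N : ℝ) ^ ((1 : ℝ) / (2 * c)))
    (hWn : ‖ΔW n‖ ≤ 1) :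
    ‖Y (n + 1)‖ ^ 2 ≤ ‖Y n‖ ^ 2 *
      Real.exp (2 * lamc T K ph ps g / N + 2 * lamc T K ph ps g * ‖ΔW n‖ ^ 2
        + 2 * alph (T / N) g (Y n) (ΔW n)) := by
  have hN1 : (1 : ℝ) ≤ N := by exact_mod_cast hN
  have hN0 : (0 : ℝ) < N := by positivity
  rw [hYrec n]
  generalize Y n = y at hYlow hYhigh ⊢
  generalize ΔW n = w at hWn ⊢
  have hr : 0 < ‖y‖ := by linarith
  have hh : 0 < T / N := by positivity
  set h : ℝ := T / N with hh_def
  -- `q = N ^ (-1/2)` is the scale of the tamed drift increment.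
  set q : ℝ := (√(N : ℝ))⁻¹ with hq_def
  have hsq0 : 0 < √(N : ℝ) := Real.sqrt_pos.2 hN0
  have hq0 : 0 < q := inv_pos.2 hsq0
  have hqsq : q ^ 2 = 1 / N := by rw [hq_def, inv_pow, Real.sq_sqrt hN0.le, one_div]
  have hq1 : q ≤ 1 := inv_le_one_of_one_le₀ (Real.one_le_sqrt.2 hN1)
  have hhq : h = T * q ^ 2 := by rw [hqsq, hh_def]; ring
  have hqN : q * √(N : ℝ) = 1 := inv_mul_cancel₀ hsq0.ne'
  have hrc : ‖y‖ ^ c ≤ √(N : ℝ) := by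
    calc ‖y‖ ^ c ≤ ((N : ℝ) ^ ((1 : ℝ) / (2 * c))) ^ c := by gcongr
      _ = √(N : ℝ) := by
        rw [← Real.rpow_mul hN0.le, Real.sqrt_eq_rpow]
        congr 1
        field_simp
  set L : ℝ := ⨆ j : Fin m × Fin m, ‖Lg g j.1 j.2 0‖ with hL_def
  have hLle : ∀ j₁ j₂, ‖Lg g j₁ j₂ 0‖ ≤ L := fun j₁ j₂ =>
    le_ciSup (f := fun j : Fin m × Fin m => ‖Lg g j.1 j.2 0‖) (Set.finite_range _).bddAbove (j₁, j₂)
  have hL0 : 0 ≤ L := Real.iSup_nonneg fun _ => norm_nonneg _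
  set M : Vec d := ∑ j₁, ∑ j₂, (w j₁ * w j₂ - (if j₁ = j₂ then h else 0)) • Lg g j₁ j₂ y with hM_def
  set t : ℝ := 1 / (1 + ‖ps y‖ * h) with ht_def
  have hden : 1 ≤ 1 + ‖ps y‖ * h := le_add_of_nonneg_right (by positivity)
  have ht0 : 0 ≤ t := by positivity
  have ht1 : t ≤ 1 := by rw [ht_def, div_le_one (by linarith)]; exact hden
  have hstep : milstep h ph ps g y w
      = y + ((h • ph y + (h * t) • ps y) + (Gclm g y w + (2⁻¹ : ℝ) • M)) := by
    rw [milstep, ht_def, mul_one_div]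
    abel
  -- growth of the coefficients
  have hph : ‖ph y‖ ≤ (‖ph 0‖ + K) * ‖y‖ := norm_le_mul_of_lipschitz hphLip le_rfl hYlow
  have hps : ‖ps y‖ ≤ (‖ps 0‖ + K * √(N : ℝ)) * ‖y‖ := by
    have hgrow := norm_le_of_fderiv_growth (by linarith) (by linarith) hpsC hps' y
    have hlow : ‖ps 0‖ ≤ ‖ps 0‖ * ‖y‖ := le_mul_of_one_le_right (norm_nonneg _) hYlow
    have hhigh : K * ‖y‖ ^ c * ‖y‖ ≤ K * √(N : ℝ) * ‖y‖ := by gcongr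
    linarith
  have hG : ‖Gclm g y w‖ ≤ (‖Gclm g 0‖ + K) * ‖y‖ * ‖w‖ :=
    (Gclm g y).le_of_opNorm_le (norm_le_mul_of_lipschitz hgLip le_rfl hYlow) w
  have hM : ‖M‖ ≤ (m : ℝ) ^ 2 * ((‖w‖ ^ 2 + h) * ((L + K) * ‖y‖)) :=
    norm_milstein_correction_le hh.le w _ fun j₁ j₂ =>
      norm_le_mul_of_lipschitz (hLgLip j₁ j₂) (hLle j₁ j₂) hYlow
  have hhT : h ≤ T * q := by
    rw [hhq]
    gcongr
    exact pow_le_of_le_one hq0.le hq1 two_ne_zero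
  have hhsqrt : h * √(N : ℝ) = T * q := by
    rw [hhq]
    linear_combination T * q * hqN
  have hdrift : ‖h • ph y + (h * t) • ps y‖ ≤ T * (‖ph 0‖ + ‖ps 0‖ + 2 * K) * q * ‖y‖ := by
    have hA : ‖h • ph y‖ ≤ T * q * ((‖ph 0‖ + K) * ‖y‖) := by
      rw [norm_smul, Real.norm_of_nonneg hh.le]
      gcongr
    have hB : ‖(h * t) • ps y‖ ≤ T * q * ((‖ps 0‖ + K) * ‖y‖) := by
      rw [norm_smul, Real.norm_of_nonneg (by positivity)]
      calc h * t * ‖ps y‖ ≤ h * 1 * ((‖ps 0‖ + K * √(N : ℝ)) * ‖y‖) := by gcongr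
        _ = h * (‖ps 0‖ * ‖y‖) + h * √(N : ℝ) * (K * ‖y‖) := by ring
        _ ≤ T * q * (‖ps 0‖ * ‖y‖) + T * q * (K * ‖y‖) := by rw [hhsqrt]; gcongr
        _ = T * q * ((‖ps 0‖ + K) * ‖y‖) := by ring
    calc _ ≤ _ := norm_add_le _ _
      _ ≤ _ := add_le_add hA hB
      _ = _ := by ring
  have hnoise : ‖Gclm g y w + (2⁻¹ : ℝ) • M‖
      ≤ (‖Gclm g 0‖ + K) * ‖y‖ * ‖w‖
        + 2⁻¹ * ((m : ℝ) ^ 2 * ((‖w‖ + T * q) * ((L + K) * ‖y‖))) := by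
    refine (norm_add_le _ _).trans (add_le_add hG ?_)
    rw [norm_smul, Real.norm_of_nonneg (by norm_num)]
    have hw2 : ‖w‖ ^ 2 ≤ ‖w‖ := pow_le_of_le_one (norm_nonneg w) hWn two_ne_zero
    refine mul_le_mul_of_nonneg_left (hM.trans ?_) (by norm_num)
    gcongr
  set S : ℝ := 1 + 4 * T * K + 2 * T * (‖ph 0‖ + ‖ps 0‖) + 2 * K + 2 * ‖Gclm g 0‖
    + (m : ℝ) ^ 2 * (T + 1) * (K + L) with hS_def
  have hlam : lamc T K ph ps g = S ^ 2 := rfl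
  have hK0 : 0 ≤ K := by linarith
  have hTK : 0 ≤ T * K := by positivity
  have hTab : 0 ≤ T * (‖ph 0‖ + ‖ps 0‖) := by positivity
  have hmKL : 0 ≤ (m : ℝ) ^ 2 * (K + L) := by positivity
  have hmTKL : 0 ≤ (m : ℝ) ^ 2 * (K + L) * T := by positivity
  have hγ : 0 ≤ ‖Gclm g 0‖ := norm_nonneg _
  have hS1 : 1 ≤ S := by rw [hS_def]; linarith
  have hincr : ‖(h • ph y + (h * t) • ps y) + (Gclm g y w + (2⁻¹ : ℝ) • M)‖
      ≤ ‖y‖ * (S / 2 * (q + ‖w‖)) := by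
    have hP : T * (‖ph 0‖ + ‖ps 0‖ + 2 * K) + 2⁻¹ * ((m : ℝ) ^ 2 * (K + L) * T) ≤ S / 2 := by
      rw [hS_def]; linarith
    have hQ : ‖Gclm g 0‖ + K + 2⁻¹ * ((m : ℝ) ^ 2 * (K + L)) ≤ S / 2 := by
      rw [hS_def]; linarith
    calc _ ≤ _ := norm_add_le _ _
      _ ≤ _ := add_le_add hdrift hnoise
      _ = ‖y‖ * ((T * (‖ph 0‖ + ‖ps 0‖ + 2 * K) + 2⁻¹ * ((m : ℝ) ^ 2 * (K + L) * T)) * q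
            + (‖Gclm g 0‖ + K + 2⁻¹ * ((m : ℝ) ^ 2 * (K + L))) * ‖w‖) := by ring
      _ ≤ ‖y‖ * (S / 2 * q + S / 2 * ‖w‖) := by gcongr
      _ = _ := by ring
  have hincr2 : ‖(h • ph y + (h * t) • ps y) + (Gclm g y w + (2⁻¹ : ℝ) • M)‖ ^ 2
      ≤ ‖y‖ ^ 2 * (S ^ 2 * (1 / N + ‖w‖ ^ 2)) := by
    calc _ ≤ (‖y‖ * (S / 2 * (q + ‖w‖))) ^ 2 := by gcongr
      _ = ‖y‖ ^ 2 * (S ^ 2 * ((q + ‖w‖) ^ 2 / 4)) := by ring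
      _ ≤ ‖y‖ ^ 2 * (S ^ 2 * (q ^ 2 + ‖w‖ ^ 2)) := by
        gcongr
        linear_combination (1 / 4) * sq_nonneg (q - ‖w‖) + (1 / 2) * sq_nonneg q
          + (1 / 2) * sq_nonneg ‖w‖
      _ = _ := by rw [hqsq]
  have hinner : 2 * ⟪y, h • ph y + (h * t) • ps y⟫ ≤ ‖y‖ ^ 2 * (S ^ 2 * (1 / N)) := by
    have hmono := hOSL y 0
    rw [sub_zero] at hmono
    have hkey := inner_tamed_drift_le hYlow ht0 ht1 hmono hph
    have hS2 : 2 * T * (K + ‖ph 0‖ + ‖ps 0‖) ≤ S ^ 2 := by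
      have : 2 * T * (K + ‖ph 0‖ + ‖ps 0‖) ≤ S := by rw [hS_def]; linarith
      exact this.trans (le_self_pow₀ hS1 two_ne_zero)
    rw [inner_add_right, real_inner_smul_right, real_inner_smul_right]
    calc 2 * (h * ⟪y, ph y⟫ + h * t * ⟪y, ps y⟫) = 2 * h * (⟪y, ph y⟫ + t * ⟪y, ps y⟫) := by ring
      _ ≤ 2 * h * ((K + ‖ph 0‖ + ‖ps 0‖) * ‖y‖ ^ 2) := by gcongr
      _ = ‖y‖ ^ 2 * (2 * T * (K + ‖ph 0‖ + ‖ps 0‖) * (1 / N)) := by rw [hh_def]; ring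
      _ ≤ _ := by gcongr
  have hα : ⟪y, Gclm g y w + (2⁻¹ : ℝ) • M⟫ = ‖y‖ ^ 2 * alph h g y w := by
    rw [alph, if_pos hYlow, ← hM_def]
    simp only [real_inner_smul_left, real_inner_smul_right, inner_add_right]
    field_simp
  calc ‖milstep h ph ps g y w‖ ^ 2
      = ‖y‖ ^ 2 + 2 * ⟪y, h • ph y + (h * t) • ps y⟫ + 2 * (‖y‖ ^ 2 * alph h g y w)
        + ‖(h • ph y + (h * t) • ps y) + (Gclm g y w + (2⁻¹ : ℝ) • M)‖ ^ 2 := by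
        rw [hstep, norm_add_sq_real, inner_add_right, hα]
        ring
    _ ≤ ‖y‖ ^ 2 + ‖y‖ ^ 2 * (S ^ 2 * (1 / N)) + 2 * (‖y‖ ^ 2 * alph h g y w)
        + ‖y‖ ^ 2 * (S ^ 2 * (1 / N + ‖w‖ ^ 2)) := by gcongr
    _ ≤ ‖y‖ ^ 2 * ((2 * S ^ 2 / N + 2 * S ^ 2 * ‖w‖ ^ 2 + 2 * alph h g y w) + 1) := by
        have : 0 ≤ ‖y‖ ^ 2 * (S ^ 2 * ‖w‖ ^ 2) := by positivity
        linear_combination this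
    _ ≤ _ := by
        rw [hlam]
        gcongr
        exact Real.add_one_le_exp _
end
end

section
/- Under Assumption 2.1 and the probabilistic setup below, define for each N the event Ω_N = {ω ∈ Ω : sup_{0≤k≤N−1} D_k(ω) ≤ N^{1/(2c)} and sup_{0≤k≤N−1} ‖ΔW_k(ω)‖ ≤ 1}. Then for each p ≥ 1 there is a finite constant B (independent of N) such that N^p·ℙ(Ω_N^c) ≤ B for all N ∈ ℕ. (Lemma 2.5.) -/
open MeasureTheory ProbabilityTheory Real Finset
open scoped RealInnerProductSpace ENNReal NNReal

noncomputable section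

/-- Gaussian exponential square moment in one dimension. -/
lemma integrable_exp_sq_gaussianReal {h M : ℝ} (hh : 0 < h) (hM : 4 * M * h ≤ 1) :
    Integrable (fun x : ℝ => rexp (M * x ^ 2)) (gaussianReal 0 (Real.toNNReal h)) := by
  have hv : Real.toNNReal h ≠ 0 := by simpa using hh
  rw [gaussianReal_of_var_ne_zero _ hv, integrable_withDensity_iff (measurable_gaussianPDF _ _)
    (ae_of_all _ fun x => gaussianPDF_lt_top)]
  have hb : 0 < 1 / (2 * h) - M := by
    rw [sub_pos, lt_div_iff₀ (by positivity)]; nlinarith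
  refine ((integrable_exp_neg_mul_sq hb).const_mul (√(2 * π * h))⁻¹).congr (ae_of_all _ fun x => ?_)
  simp only [toReal_gaussianPDF, gaussianPDFReal, Real.coe_toNNReal _ hh.le]
  rw [mul_left_comm, ← Real.exp_add]
  congr 2
  field_simp
  ring

lemma integral_exp_sq_gaussianReal_le {h M : ℝ} (hh : 0 < h) (hM0 : 0 ≤ M) (hM : 4 * M * h ≤ 1) :
    ∫ x : ℝ, rexp (M * x ^ 2) ∂(gaussianReal 0 (Real.toNNReal h)) ≤ rexp (2 * M * h) := by
  have hv : Real.toNNReal h ≠ 0 := by simpa using hh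
  have hb : 0 < 1 / (2 * h) - M := by
    rw [sub_pos, lt_div_iff₀ (by positivity)]; nlinarith
  have hlt : 0 < 1 - 2 * M * h := by nlinarith
  have hint : ∫ x : ℝ, rexp (M * x ^ 2) ∂(gaussianReal 0 (Real.toNNReal h))
      = (√(2 * π * h))⁻¹ * √(π / (1 / (2 * h) - M)) := by
    rw [integral_gaussianReal_eq_integral_smul hv, ← integral_gaussian, ← integral_const_mul]
    congr 1 with x
    simp only [gaussianPDFReal, Real.coe_toNNReal _ hh.le, smul_eq_mul]
    rw [mul_assoc, ← Real.exp_add]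
    congr 2
    field_simp
    ring
  rw [hint, ← Real.sqrt_inv, ← Real.sqrt_mul (by positivity),
    show (2 * π * h)⁻¹ * (π / (1 / (2 * h) - M)) = (1 - 2 * M * h)⁻¹ by
      have : 1 / (2 * h) - M = (1 - 2 * M * h) / (2 * h) := by field_simp
      rw [this]
      field_simp]
  refine Real.sqrt_le_iff.2 ⟨(Real.exp_pos _).le, ?_⟩
  rw [← Real.exp_nat_mul, inv_le_comm₀ hlt (Real.exp_pos _), ← Real.exp_neg]
  set x := 2 * M * h with hx
  have hx0 : 0 ≤ x := by positivity
  have hx1 : x ≤ 1 / 2 := by rw [hx]; linarith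
  have h1 : (1 + x + x ^ 2 / 2) ≤ rexp x := Real.quadratic_le_exp_of_nonneg hx0
  have h2 : 1 ≤ (1 - x) * (1 + x + x ^ 2 / 2) ^ 2 := by
    nlinarith [pow_nonneg hx0 3, pow_nonneg hx0 4, pow_nonneg hx0 2,
      mul_nonneg (pow_nonneg hx0 2) (sub_nonneg.2 hx1),
      mul_nonneg (pow_nonneg hx0 3) (sub_nonneg.2 hx1),
      mul_nonneg (pow_nonneg hx0 4) (sub_nonneg.2 hx1)]
  have h3 : rexp (-(((2 : ℕ) : ℝ) * x)) = (rexp x ^ 2)⁻¹ := by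
    rw [Real.exp_neg, Real.exp_nat_mul]
  rw [h3, inv_le_iff_one_le_mul₀ (by positivity)]
  calc (1 : ℝ) ≤ (1 - x) * (1 + x + x ^ 2 / 2) ^ 2 := h2
    _ ≤ (1 - x) * rexp x ^ 2 := by gcongr

/-- The law on `ℝ^m` of a centred Gaussian vector with independent coordinates of variance `h`. -/
def gaussianVec (m : ℕ) (h : ℝ) : Measure (Vec m) :=
  Measure.map (WithLp.toLp 2) (Measure.pi (fun _ : Fin m => gaussianReal 0 (Real.toNNReal h)))

lemma lintegral_exp_sq_gaussianVec_le (m : ℕ) {h M : ℝ} (hh : 0 < h) (hM0 : 0 ≤ M)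
    (hM : 4 * M * h ≤ 1) :
    ∫⁻ w, ENNReal.ofReal (rexp (M * ‖w‖ ^ 2)) ∂(gaussianVec m h)
      ≤ ENNReal.ofReal (rexp (2 * m * M * h)) := by
  rw [gaussianVec, lintegral_map (by fun_prop) (by fun_prop)]
  have hprod : ∀ x : Fin m → ℝ, rexp (M * ‖WithLp.toLp 2 x‖ ^ 2) = ∏ i, rexp (M * x i ^ 2) := by
    intro x
    rw [← Real.exp_sum, EuclideanSpace.norm_sq_eq, Finset.mul_sum]
    simp
  simp_rw [hprod]
  rw [← ofReal_integral_eq_lintegral_ofReal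
    (Integrable.fintype_prod (f := fun (_ : Fin m) (x : ℝ) => rexp (M * x ^ 2))
      fun _ => integrable_exp_sq_gaussianReal hh hM)
    (ae_of_all _ fun x => Finset.prod_nonneg fun _ _ => (Real.exp_pos _).le)]
  refine ENNReal.ofReal_le_ofReal ?_
  rw [integral_fintype_prod_eq_prod (f := fun (_ : Fin m) (x : ℝ) => rexp (M * x ^ 2))]
  calc _ ≤ ∏ _i : Fin m, rexp (2 * M * h) := Finset.prod_le_prod
          (fun _ _ => integral_nonneg fun _ => (Real.exp_pos _).le)
          (fun _ _ => integral_exp_sq_gaussianReal_le hh hM0 hM)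
    _ = rexp (2 * m * M * h) := by
      rw [Finset.prod_const, Finset.card_univ, Fintype.card_fin, ← Real.exp_nat_mul]
      ring_nf

lemma lintegral_comp_neg_gaussianVec (m : ℕ) (h : ℝ) {f : Vec m → ℝ≥0∞} (hf : Measurable f) :
    ∫⁻ w, f (-w) ∂(gaussianVec m h) = ∫⁻ w, f w ∂(gaussianVec m h) := by
  have : (gaussianReal 0 (Real.toNNReal h)).IsNegInvariant :=
    ⟨by simpa [Measure.neg] using gaussianReal_map_neg (μ := 0) (v := Real.toNNReal h)⟩
  rw [gaussianVec, lintegral_map (by fun_prop) (by fun_prop),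
    lintegral_map (by fun_prop) (by fun_prop),
    ← lintegral_neg_eq_self (μ := Measure.pi (fun _ : Fin m => gaussianReal 0 (Real.toNNReal h)))]
  simp

/-- Exponential moments of an odd, linearly bounded function plus a quadratic term. -/
lemma lintegral_exp_odd_add_sq_gaussianVec_le (m : ℕ) {h M A : ℝ} (hh : 0 < h) (hM0 : 0 ≤ M)
    (hM : 4 * (A ^ 2 / 2 + M) * h ≤ 1) {l : Vec m → ℝ} (hl : Measurable l)
    (hodd : ∀ w, l (-w) = -l w) (hA : ∀ w, |l w| ≤ A * ‖w‖) :
    ∫⁻ w, ENNReal.ofReal (rexp (l w + M * ‖w‖ ^ 2)) ∂(gaussianVec m h)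
      ≤ ENNReal.ofReal (rexp (2 * m * (A ^ 2 / 2 + M) * h)) := by
  refine le_trans ?_ (lintegral_exp_sq_gaussianVec_le m hh (by positivity) hM)
  set f : Vec m → ℝ≥0∞ := fun w => ENNReal.ofReal (rexp (l w + M * ‖w‖ ^ 2)) with hfdef
  have hf : Measurable f := by fun_prop
  have htwo : 2 * ∫⁻ w, f w ∂(gaussianVec m h)
      ≤ 2 * ∫⁻ w, ENNReal.ofReal (rexp ((A ^ 2 / 2 + M) * ‖w‖ ^ 2)) ∂(gaussianVec m h) := by
    nth_rw 1 [two_mul]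
    nth_rw 2 [← lintegral_comp_neg_gaussianVec m h hf]
    rw [← lintegral_add_left hf, ← lintegral_const_mul _ (by fun_prop)]
    refine lintegral_mono fun w => ?_
    simp only [hfdef, hodd, norm_neg]
    rw [two_mul, ← ENNReal.ofReal_add (by positivity) (by positivity),
      ← ENNReal.ofReal_add (by positivity) (by positivity), ← two_mul]
    refine ENNReal.ofReal_le_ofReal ?_
    have hsq : l w ^ 2 ≤ A ^ 2 * ‖w‖ ^ 2 := by
      rw [← mul_pow, ← sq_abs (l w)]
      exact pow_le_pow_left₀ (abs_nonneg _) (hA w) 2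
    calc rexp (l w + M * ‖w‖ ^ 2) + rexp (-l w + M * ‖w‖ ^ 2)
        = 2 * (Real.cosh (l w) * rexp (M * ‖w‖ ^ 2)) := by
          rw [Real.exp_add, Real.exp_add, Real.cosh_eq]; ring
      _ ≤ 2 * (rexp (l w ^ 2 / 2) * rexp (M * ‖w‖ ^ 2)) := by
          gcongr; exact Real.cosh_le_exp_half_sq _
      _ ≤ 2 * rexp ((A ^ 2 / 2 + M) * ‖w‖ ^ 2) := by
          rw [← Real.exp_add]
          gcongr
          linarith
  exact (ENNReal.mul_le_mul_iff_right (by norm_num) (by norm_num)).1 htwo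

section RandomRecursion

variable {Ω α β E F : Type*} [MeasurableSpace Ω] [MeasurableSpace α] [MeasurableSpace β]
  [MeasurableSpace E] [MeasurableSpace F]

lemma indepFun_prodMk_left_of_indepFun_prodMk_right {P : Measure Ω} [IsProbabilityMeasure P]
    {X : Ω → α} {A : Ω → β} {B : Ω → F} (hX : Measurable X) (hA : Measurable A)
    (hB : Measurable B) (hXAB : IndepFun X (fun ω => (A ω, B ω)) P) (hAB : IndepFun A B P) :
    IndepFun (fun ω => (X ω, A ω)) B P := by
  have hXA : IndepFun X A P := hXAB.comp measurable_id measurable_fst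
  have := Measure.isProbabilityMeasure_map (μ := P) hX.aemeasurable
  have := Measure.isProbabilityMeasure_map (μ := P) hA.aemeasurable
  have := Measure.isProbabilityMeasure_map (μ := P) hB.aemeasurable
  rw [indepFun_iff_map_prod_eq_prod_map_map (by fun_prop) (by fun_prop)] at hXA hAB hXAB ⊢
  rw [hAB] at hXAB
  rw [hXA]
  have h := congrArg (Measure.map (MeasurableEquiv.prodAssoc (α := α) (β := β) (γ := F)).symm) hXAB
  rw [Measure.map_map (by fun_prop) (by fun_prop), ← Measure.prodAssoc_prod,
    MeasurableEquiv.map_symm_map] at h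
  exact h

lemma lintegral_le_of_indepFun {P : Measure Ω} [IsProbabilityMeasure P]
    {Z : Ω → α} {W : Ω → β} (hZ : Measurable Z) (hW : Measurable W) (hZW : IndepFun Z W P)
    {f : α × β → ℝ≥0∞} (hf : Measurable f) {H : α → ℝ≥0∞} (hH : Measurable H)
    (hle : ∀ z, ∫⁻ w, f (z, w) ∂(Measure.map W P) ≤ H z) :
    ∫⁻ ω, f (Z ω, W ω) ∂P ≤ ∫⁻ ω, H (Z ω) ∂P := by
  have := Measure.isProbabilityMeasure_map (μ := P) hW.aemeasurable
  rw [← lintegral_map (f := f) (g := fun ω => (Z ω, W ω)) hf (by fun_prop),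
    (indepFun_iff_map_prod_eq_prod_map_map hZ.aemeasurable hW.aemeasurable).1 hZW,
    lintegral_prod _ hf.aemeasurable, ← lintegral_map hH hZ]
  exact lintegral_mono hle

/-- Exponential moments of additive functionals of a random recursion driven by independent
noise, when the one-step exponential moments are bounded uniformly in the state. -/
lemma lintegral_exp_sum_recursion_le {P : Measure Ω} [IsProbabilityMeasure P]
    {ξ : Ω → E} {W : ℕ → Ω → F} {Y : ℕ → Ω → E} {st : E × F → E} {G : E × F → ℝ} {κ : ℝ}
    (hκ : 0 ≤ κ) (hξ : Measurable ξ) (hW : ∀ k, Measurable (W k)) (hindep : iIndepFun W P)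
    (hξW : IndepFun ξ (fun ω k => W k ω) P) (hst : Measurable st) (hG : Measurable G)
    (hY0 : ∀ ω, Y 0 ω = ξ ω) (hY : ∀ n ω, Y (n + 1) ω = st (Y n ω, W n ω))
    (hstep : ∀ k y, ∫⁻ w, ENNReal.ofReal (rexp (G (y, w))) ∂(Measure.map (W k) P)
      ≤ ENNReal.ofReal (rexp κ)) (u n : ℕ) :
    ∫⁻ ω, ENNReal.ofReal (rexp (∑ k ∈ Finset.Ico u n, G (Y k ω, W k ω))) ∂P
      ≤ ENNReal.ofReal (rexp (κ * n)) := by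
  have hpast : ∀ k, IndepFun (fun ω => (ξ ω, fun i : Finset.range k => W i ω)) (W k) P := by
    intro k
    refine indepFun_prodMk_left_of_indepFun_prodMk_right hξ (by fun_prop) (hW k) ?_ ?_
    · exact hξW.comp (φ := id)
        (ψ := fun w : ℕ → F => ((fun i : Finset.range k => w i), w k)) measurable_id (by fun_prop)
    · have h := hindep.indepFun_finset (Finset.range k) {k} (by simp) hW
      exact h.comp (φ := id)
        (ψ := fun w : ({k} : Finset ℕ) → F => w ⟨k, by simp⟩) measurable_id (by fun_prop)
  have hYpast : ∀ k j, j ≤ k → Measurable[MeasurableSpace.comap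
      (fun ω => (ξ ω, fun i : Finset.range k => W i ω)) inferInstance] (Y j) := by
    intro k j
    have hcomap := comap_measurable (m := inferInstance)
      (fun ω => (ξ ω, fun i : Finset.range k => W i ω))
    induction j with
    | zero =>
      intro _
      rw [funext hY0]
      exact measurable_fst.comp hcomap
    | succ j ih =>
      intro hjk
      rw [funext (hY j)]
      refine hst.comp ((ih (by omega)).prodMk ?_)
      exact (measurable_pi_apply (⟨j, by simpa using hjk⟩ : Finset.range k)).comp
        (measurable_snd.comp hcomap)
  have hWpast : ∀ k j, j < k → Measurable[MeasurableSpace.comap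
      (fun ω => (ξ ω, fun i : Finset.range k => W i ω)) inferInstance] (W j) := by
    intro k j hjk
    exact (measurable_pi_apply (⟨j, by simpa using hjk⟩ : Finset.range k)).comp
      (measurable_snd.comp (comap_measurable (fun ω => (ξ ω, fun i : Finset.range k => W i ω))))
  induction n with
  | zero => simp
  | succ n ih =>
    have hmono : ENNReal.ofReal (rexp (κ * n)) ≤ ENNReal.ofReal (rexp (κ * (n + 1 : ℕ))) := by
      refine ENNReal.ofReal_le_ofReal (Real.exp_le_exp.2 ?_)
      push_cast
      nlinarith
    by_cases hun : u ≤ n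
    swap
    · refine le_trans (le_of_eq ?_) (ih.trans hmono)
      rw [Finset.Ico_eq_empty (by omega), Finset.Ico_eq_empty (by omega)]
    set Z : Ω → E × ℝ := fun ω => (Y n ω, ∑ k ∈ Finset.Ico u n, G (Y k ω, W k ω)) with hZdef
    have hZpast : Measurable[MeasurableSpace.comap
        (fun ω => (ξ ω, fun i : Finset.range n => W i ω)) inferInstance] Z := by
      refine (hYpast n n le_rfl).prodMk (Finset.measurable_fun_sum _ fun k hk => ?_)
      have hk' := (Finset.mem_Ico.1 hk).2
      exact hG.comp ((hYpast n k hk'.le).prodMk (hWpast n k hk'))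
    have hpm : Measurable (fun ω => (ξ ω, fun i : Finset.range n => W i ω)) := by fun_prop
    have hZ : Measurable Z := hZpast.mono hpm.comap_le le_rfl
    have hZW : IndepFun Z (W n) P := by
      have h := (IndepFun_iff_Indep _ _ _).1 (hpast n)
      exact (IndepFun_iff_Indep _ _ _).2 (indep_of_indep_of_le_left h hZpast.comap_le)
    have key := lintegral_le_of_indepFun hZ (hW n) hZW
      (f := fun z => ENNReal.ofReal (rexp (z.1.2 + G (z.1.1, z.2))))
      (H := fun z => ENNReal.ofReal (rexp z.2) * ENNReal.ofReal (rexp κ))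
      (by fun_prop) (by fun_prop) (by
        intro z
        simp_rw [Real.exp_add, ENNReal.ofReal_mul (Real.exp_pos _).le]
        rw [lintegral_const_mul _ (by fun_prop)]
        gcongr
        exact hstep n z.1)
    simp_rw [Finset.sum_Ico_succ_top hun]
    refine key.trans ?_
    rw [lintegral_mul_const _ (by fun_prop)]
    refine (mul_le_mul_left ih _).trans (le_of_eq ?_)
    rw [← ENNReal.ofReal_mul (Real.exp_pos _).le, ← Real.exp_add]
    push_cast
    ring_nf

end RandomRecursion

lemma continuous_of_norm_sub_le {V V' : Type*} [NormedAddCommGroup V] [NormedAddCommGroup V']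
    {f : V → V'} {K : ℝ} (hf : ∀ x y, ‖f x - f y‖ ≤ K * ‖x - y‖) : Continuous f :=
  (LipschitzWith.of_dist_le' (K := K) fun x y => by simpa [dist_eq_norm] using hf x y).continuous

lemma Gclm_apply {d m : ℕ} (g : Fin m → Vec d → Vec d) (x : Vec d) (w : Vec m) :
    Gclm g x w = ∑ j, w j • g j x := rfl

lemma measurable_milstep {d m : ℕ} (h : ℝ) {ph ps : Vec d → Vec d} {g : Fin m → Vec d → Vec d}
    (hph : Continuous ph) (hps : Continuous ps) (hg : ∀ j, Continuous (g j))
    (hL : ∀ j₁ j₂, Continuous (Lg g j₁ j₂)) :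
    Measurable (fun z : Vec d × Vec m => milstep h ph ps g z.1 z.2) := by
  have := hph.measurable
  have := hps.measurable
  have := fun j => (hg j).measurable
  have := fun j₁ j₂ => (hL j₁ j₂).measurable
  simp only [milstep, Gclm_apply]
  fun_prop

lemma measurable_alph {d m : ℕ} (h : ℝ) {g : Fin m → Vec d → Vec d}
    (hg : ∀ j, Continuous (g j)) (hL : ∀ j₁ j₂, Continuous (Lg g j₁ j₂)) :
    Measurable (fun z : Vec d × Vec m => alph h g z.1 z.2) := by
  have := fun j => (hg j).measurable
  have := fun j₁ j₂ => (hL j₁ j₂).measurable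
  simp only [alph, Gclm_apply]
  refine Measurable.ite (measurableSet_le measurable_const (by fun_prop)) ?_ measurable_const
  exact (Measurable.inner (by fun_prop) (by fun_prop)).add
    (Measurable.inner (by fun_prop) (by fun_prop))

/-- `α` is dominated by an odd linearly bounded function of the increment plus a quadratic term. -/
lemma alph_le {d m : ℕ} {h K b : ℝ} (hh : 0 ≤ h) (hK : 0 ≤ K) (hb : K ≤ b)
    {g : Fin m → Vec d → Vec d}
    (hgLip : ∀ x y : Vec d, ‖Gclm g x - Gclm g y‖ ≤ K * ‖x - y‖)
    (hLgLip : ∀ (j₁ j₂ : Fin m) (x y : Vec d), ‖Lg g j₁ j₂ x - Lg g j₁ j₂ y‖ ≤ K * ‖x - y‖)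
    (hL0 : ∀ j₁ j₂, K + ‖Lg g j₁ j₂ 0‖ ≤ b) (y : Vec d) :
    ∃ l : Vec m → ℝ, Measurable l ∧ (∀ w, l (-w) = -l w) ∧
      (∀ w, |l w| ≤ (K + ‖Gclm g 0‖) * ‖w‖) ∧
      ∀ w, alph h g y w ≤ l w + b * m ^ 2 * ‖w‖ ^ 2 + b * m ^ 2 * h := by
  have hb0 : 0 ≤ b := hK.trans hb
  by_cases hy : 1 ≤ ‖y‖
  swap
  · refine ⟨fun _ => 0, measurable_const, by simp, fun w => by simp; positivity, fun w => ?_⟩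
    rw [alph, if_neg hy]
    positivity
  have hy0 : 0 < ‖y‖ := by linarith
  have hunit : ‖‖y‖⁻¹ • y‖ = 1 := by
    rw [norm_smul, norm_inv, norm_norm, inv_mul_cancel₀ hy0.ne']
  have hinner : ∀ v : Vec d, |⟪‖y‖⁻¹ • y, v⟫| ≤ ‖v‖ := fun v => by
    simpa [hunit] using abs_real_inner_le_norm (‖y‖⁻¹ • y) v
  have hgrow : ∀ {V : Type} [NormedAddCommGroup V] (f : Vec d → V),
      ‖f y - f 0‖ ≤ K * ‖y - 0‖ → ‖f y‖ ≤ (K + ‖f 0‖) * ‖y‖ := by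
    intro V _ f hf
    have h1 : ‖f y‖ ≤ ‖f y - f 0‖ + ‖f 0‖ := by simpa using norm_add_le (f y - f 0) (f 0)
    rw [sub_zero] at hf
    nlinarith [norm_nonneg (f 0)]
  refine ⟨fun w => ⟪‖y‖⁻¹ • y, ‖y‖⁻¹ • (Gclm g y w)⟫, ?_, by simp, fun w => ?_, fun w => ?_⟩
  · exact (Continuous.inner (𝕜 := ℝ) continuous_const
      ((Gclm g y).continuous.const_smul ‖y‖⁻¹)).measurable
  · refine (hinner _).trans ?_
    rw [norm_smul, norm_inv, norm_norm, inv_mul_le_iff₀ hy0]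
    calc ‖Gclm g y w‖ ≤ ‖Gclm g y‖ * ‖w‖ := (Gclm g y).le_opNorm w
      _ ≤ ((K + ‖Gclm g 0‖) * ‖y‖) * ‖w‖ := by
        gcongr
        exact hgrow (Gclm g) (hgLip y 0)
      _ = ‖y‖ * ((K + ‖Gclm g 0‖) * ‖w‖) := by ring
  · rw [alph, if_pos hy, add_assoc]
    gcongr
    refine (le_abs_self _).trans ((hinner _).trans ?_)
    have hcoef : ∀ j₁ j₂ : Fin m,
        |w j₁ * w j₂ - (if j₁ = j₂ then h else 0)| ≤ ‖w‖ ^ 2 + h := by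
      intro j₁ j₂
      have h1 : |w j₁ * w j₂| ≤ ‖w‖ ^ 2 := by
        rw [abs_mul, sq]
        exact mul_le_mul (PiLp.norm_apply_le w j₁) (PiLp.norm_apply_le w j₂) (abs_nonneg _)
          (norm_nonneg _)
      have h2 : |if j₁ = j₂ then h else 0| ≤ h := by
        split_ifs <;> simp [abs_of_nonneg hh, hh]
      exact (abs_sub _ _).trans (add_le_add h1 h2)
    have hsum : ‖∑ j₁, ∑ j₂, (w j₁ * w j₂ - (if j₁ = j₂ then h else 0)) • Lg g j₁ j₂ y‖
        ≤ ∑ _j₁ : Fin m, ∑ _j₂ : Fin m, (‖w‖ ^ 2 + h) * (b * ‖y‖) := by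
      refine (norm_sum_le _ _).trans (Finset.sum_le_sum fun j₁ _ => ?_)
      refine (norm_sum_le _ _).trans (Finset.sum_le_sum fun j₂ _ => ?_)
      rw [norm_smul]
      refine mul_le_mul (hcoef j₁ j₂) ?_ (norm_nonneg _) (by positivity)
      refine (hgrow _ (hLgLip j₁ j₂ y 0)).trans ?_
      gcongr
      exact hL0 j₁ j₂
    rw [norm_smul, Real.norm_of_nonneg (by positivity), inv_mul_le_iff₀ (by positivity)]
    refine hsum.trans ?_
    simp only [Finset.sum_const, Finset.card_univ, Fintype.card_fin, nsmul_eq_mul]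
    have : 0 ≤ (m : ℝ) ^ 2 * (‖w‖ ^ 2 + h) * (b * ‖y‖) := by positivity
    nlinarith

lemma natCast_rpow_eq_ofReal_rpow {N : ℕ} (hN : 0 < N) (a : ℝ) :
    (N : ℝ≥0∞) ^ a = ENNReal.ofReal ((N : ℝ) ^ a) := by
  rw [← ENNReal.ofReal_rpow_of_pos (by exact_mod_cast hN), ENNReal.ofReal_natCast]

/-- A union bound over `N` events costs one power of `N`. -/
lemma natCast_rpow_mul_sum_le {N : ℕ} (hN : 0 < N) {a : ℝ} {x : ℕ → ℝ≥0∞} {C : ℝ≥0∞}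
    (hx : ∀ i ∈ Finset.range N, (N : ℝ≥0∞) ^ (a + 1) * x i ≤ C) :
    (N : ℝ≥0∞) ^ a * ∑ i ∈ Finset.range N, x i ≤ C := by
  have hN0 : (N : ℝ≥0∞) ≠ 0 := by exact_mod_cast hN.ne'
  have hNt : (N : ℝ≥0∞) ≠ ∞ := ENNReal.natCast_ne_top N
  rw [← ENNReal.mul_le_mul_iff_right hN0 hNt, ← mul_assoc]
  have hpow : (N : ℝ≥0∞) * (N : ℝ≥0∞) ^ a = (N : ℝ≥0∞) ^ (a + 1) := by
    rw [ENNReal.rpow_add _ _ hN0 hNt, ENNReal.rpow_one, mul_comm]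
  rw [hpow, Finset.mul_sum]
  simpa using Finset.sum_le_sum hx

/-- Markov's inequality for a set on which a real function is bounded below. -/
lemma ofReal_mul_measure_le_lintegral {Ω : Type*} [MeasurableSpace Ω] {P : Measure Ω}
    {f : Ω → ℝ} (hf : Measurable f) {a : ℝ} {S : Set Ω} (hS : ∀ ω ∈ S, a ≤ f ω) :
    ENNReal.ofReal a * P S ≤ ∫⁻ ω, ENNReal.ofReal (f ω) ∂P :=
  (mul_le_mul_right (measure_mono fun ω hω => ENNReal.ofReal_le_ofReal (hS ω hω)) _).trans
    (mul_meas_ge_le_lintegral (ENNReal.measurable_ofReal.comp hf) _)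

lemma lintegral_add_norm_pow_ne_top {V : Type*} [NormedAddCommGroup V] [MeasurableSpace V]
    {μ : Measure V} [IsFiniteMeasure μ] {lam : ℝ} (hlam : 0 ≤ lam) (r : ℕ)
    (hr : Integrable (fun x : V => ‖x‖ ^ r) μ) :
    ∫⁻ x, ENNReal.ofReal ((lam + ‖x‖) ^ r) ∂μ ≠ ∞ := by
  have hint : Integrable (fun x : V => (2 : ℝ) ^ (r - 1) * (lam ^ r + ‖x‖ ^ r)) μ :=
    ((integrable_const _).add hr).const_mul _
  refine ne_top_of_le_ne_top hint.lintegral_lt_top.ne (lintegral_mono fun x => ?_)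
  exact ENNReal.ofReal_le_ofReal (add_pow_le hlam (norm_nonneg _) r)

lemma exists_natCast_rpow_mul_exp_neg_le (a : ℝ) {b : ℝ} (hb : 0 < b) :
    ∃ C : ℝ, ∀ n : ℕ, (n : ℝ) ^ a * rexp (-b * n) ≤ C := by
  obtain ⟨C, hC⟩ := ((tendsto_rpow_mul_exp_neg_mul_atTop_nhds_zero a b hb).comp
    tendsto_natCast_atTop_atTop).bddAbove_range
  exact ⟨C, fun n => hC ⟨n, rfl⟩⟩

/-- Deterministic decomposition of the event that `D_n` exceeds the square of a level. -/
lemma exists_lt_of_sq_lt_Dproc {lam x a : ℝ} (ha : 0 ≤ a) {w2 al : ℕ → ℝ} {n : ℕ}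
    (h : a * a < Dproc lam x w2 al n) :
    a < lam + x ∨ ∃ u ≤ n, a < rexp (lam + ∑ k ∈ Finset.Ico u n, (lam * w2 k + al k)) := by
  obtain ⟨u, hu, hsup⟩ := Finset.exists_mem_eq_sup' (s := Finset.range (n + 1))
    Finset.nonempty_range_add_one (fun u => ∑ k ∈ Finset.Ico u n, (lam * w2 k + al k))
  rw [Dproc, hsup] at h
  by_contra! hcon
  exact absurd h (not_lt.2 (mul_le_mul hcon.1
    (hcon.2 u (by simpa [Nat.lt_succ_iff] using hu)) (Real.exp_pos _).le ha))

lemma measurable_milstep_recursion {d m : ℕ} {Ω : Type*} [MeasurableSpace Ω] {h : ℝ}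
    {ph ps : Vec d → Vec d} {g : Fin m → Vec d → Vec d} (hph : Continuous ph)
    (hps : Continuous ps) (hg : ∀ j, Continuous (g j)) (hL : ∀ j₁ j₂, Continuous (Lg g j₁ j₂))
    {ξ : Ω → Vec d} {W : ℕ → Ω → Vec m} {Y : ℕ → Ω → Vec d} (hξ : Measurable ξ)
    (hW : ∀ k, Measurable (W k)) (hY0 : ∀ ω, Y 0 ω = ξ ω)
    (hY : ∀ n ω, Y (n + 1) ω = milstep h ph ps g (Y n ω) (W n ω)) (k : ℕ) :
    Measurable (Y k) := by
  induction k with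
  | zero => rwa [funext hY0]
  | succ k ih =>
    have hcomp := (measurable_milstep h hph hps hg hL).comp (ih.prodMk (hW k))
    rw [funext (hY k)]
    exact hcomp

/-- Uniform one-step exponential moment bound for `λ‖ΔW‖² + α`. -/
lemma lintegral_exp_alph_le {d m : ℕ} {h K b lam q M : ℝ} (hh : 0 < h) (hK : 0 ≤ K) (hb : K ≤ b)
    (hlam : 0 ≤ lam) (hq : 0 ≤ q) {g : Fin m → Vec d → Vec d}
    (hgLip : ∀ x y : Vec d, ‖Gclm g x - Gclm g y‖ ≤ K * ‖x - y‖)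
    (hLgLip : ∀ (j₁ j₂ : Fin m) (x y : Vec d), ‖Lg g j₁ j₂ x - Lg g j₁ j₂ y‖ ≤ K * ‖x - y‖)
    (hL0 : ∀ j₁ j₂, K + ‖Lg g j₁ j₂ 0‖ ≤ b)
    (hM : M = (q * (K + ‖Gclm g 0‖)) ^ 2 / 2 + q * (lam + b * m ^ 2))
    (hsmall : 4 * M * h ≤ 1) (y : Vec d) :
    ∫⁻ w, ENNReal.ofReal (rexp (q * (lam * ‖w‖ ^ 2 + alph h g y w))) ∂(gaussianVec m h)
      ≤ ENNReal.ofReal (rexp ((2 * m * M + q * (b * m ^ 2)) * h)) := by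
  have hb0 : 0 ≤ b := hK.trans hb
  obtain ⟨l, hl, hodd, hlA, hle⟩ := alph_le hh.le hK hb hgLip hLgLip hL0 y
  have hmom := lintegral_exp_odd_add_sq_gaussianVec_le m (M := q * (lam + b * m ^ 2))
    (A := q * (K + ‖Gclm g 0‖)) hh (by positivity) (hM ▸ hsmall)
    (hl.const_mul q) (fun w => by rw [hodd]; ring) (fun w => by
      rw [abs_mul, abs_of_nonneg hq, mul_assoc]
      exact mul_le_mul_of_nonneg_left (hlA w) hq)
  rw [← hM] at hmom
  calc _ ≤ ∫⁻ w, ENNReal.ofReal (rexp (q * l w + q * (lam + b * m ^ 2) * ‖w‖ ^ 2))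
        * ENNReal.ofReal (rexp (q * (b * m ^ 2) * h)) ∂(gaussianVec m h) := by
        refine lintegral_mono fun w => ?_
        rw [← ENNReal.ofReal_mul (Real.exp_pos _).le, ← Real.exp_add]
        refine ENNReal.ofReal_le_ofReal (Real.exp_le_exp.2 ?_)
        have := mul_le_mul_of_nonneg_left (hle w) hq
        linarith
    _ ≤ ENNReal.ofReal (rexp (2 * m * M * h))
        * ENNReal.ofReal (rexp (q * (b * m ^ 2) * h)) := by
        rw [lintegral_mul_const _ (by fun_prop)]
        exact mul_le_mul_left hmom _
    _ = ENNReal.ofReal (rexp ((2 * m * M + q * (b * m ^ 2)) * h)) := by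
        rw [← ENNReal.ofReal_mul (Real.exp_pos _).le, ← Real.exp_add]
        ring_nf

set_option maxHeartbeats 400000 in
/-- Lemma 2.5: polynomial decay of the probability of the complement of the good event. -/
theorem lemma2_5_rare_event_bound
    (d m : ℕ) (hd : 0 < d) (hm : 0 < m)
    (T K c : ℝ) (hT : 0 < T) (hK : 1 ≤ K) (hc : 1 ≤ c)
    (ph ps : Vec d → Vec d) (g : Fin m → Vec d → Vec d)
    (hgdiff : ∀ j, ContDiff ℝ 1 (g j))
    (hOSL : ∀ x y : Vec d, ⟪x - y, (ph x + ps x) - (ph y + ps y)⟫ ≤ K * ‖x - y‖ ^ 2)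
    (hgLip : ∀ x y : Vec d, ‖Gclm g x - Gclm g y‖ ≤ K * ‖x - y‖)
    (hphLip : ∀ x y : Vec d, ‖ph x - ph y‖ ≤ K * ‖x - y‖)
    (hpsC : ContDiff ℝ 1 ps)
    (hps' : ∀ x : Vec d, ‖fderiv ℝ ps x‖ ≤ K * ‖x‖ ^ c)
    (hLgLip : ∀ (j₁ j₂ : Fin m) (x y : Vec d), ‖Lg g j₁ j₂ x - Lg g j₁ j₂ y‖ ≤ K * ‖x - y‖)
    (μξ : Measure (Vec d)) (hμξprob : IsProbabilityMeasure μξ)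
    (hμξmom : ∀ r : ℕ, Integrable (fun x => ‖x‖ ^ r) μξ)
    (p : ℝ) (hp : 1 ≤ p) :
    ∃ B : ℝ, ∀ (N : ℕ), 0 < N →
      ∀ (Ω : Type) (mΩ : MeasurableSpace Ω) (P : Measure Ω), IsProbabilityMeasure P →
      ∀ (ξ : Ω → Vec d) (ΔW : ℕ → Ω → Vec m) (Y : ℕ → Ω → Vec d),
        Measurable ξ → (∀ k, Measurable (ΔW k)) →
        Measure.map ξ P = μξ →
        (∀ k, Measure.map (ΔW k) P
            = Measure.map (WithLp.toLp 2)
                (Measure.pi (fun _ : Fin m => gaussianReal 0 (Real.toNNReal (T / N))))) →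
        iIndepFun ΔW P →
        IndepFun ξ (fun ω k => ΔW k ω) P →
        (∀ ω, Y 0 ω = ξ ω) →
        (∀ n ω, Y (n + 1) ω = milstep (T / N) ph ps g (Y n ω) (ΔW n ω)) →
        (N : ℝ≥0∞) ^ p * P {ω | ¬ ((∀ k < N,
              Dproc (lamc T K ph ps g) ‖ξ ω‖ (fun l => ‖ΔW l ω‖ ^ 2)
                (fun l => alph (T / N) g (Y l ω) (ΔW l ω)) k ≤ (N : ℝ) ^ ((1 : ℝ) / (2 * c)))
            ∧ (∀ k < N, ‖ΔW k ω‖ ≤ 1))}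
          ≤ ENNReal.ofReal B := by
  have hK0 : 0 ≤ K := by linarith
  have hphc := continuous_of_norm_sub_le hphLip
  have hpsc := hpsC.continuous
  have hgc := fun j => (hgdiff j).continuous
  have hLc := fun j₁ j₂ => continuous_of_norm_sub_le (hLgLip j₁ j₂)
  set lam := lamc T K ph ps g with hlamdef
  have hlam : 0 ≤ lam := sq_nonneg _
  clear_value lam
  set b : ℝ := K + ⨆ j : Fin m × Fin m, ‖Lg g j.1 j.2 0‖ with hbdef
  have hKb : K ≤ b := le_add_of_nonneg_right (Real.iSup_nonneg fun _ => norm_nonneg _)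
  have hL0 : ∀ j₁ j₂, K + ‖Lg g j₁ j₂ 0‖ ≤ b := fun j₁ j₂ =>
    add_le_add_right
      (le_ciSup (f := fun j : Fin m × Fin m => ‖Lg g j.1 j.2 0‖) (Set.finite_range _).bddAbove
        (j₁, j₂)) K
  have hb0 : 0 ≤ b := hK0.trans hKb
  clear_value b
  set q : ℝ := 4 * c * (p + 2) with hqdef
  have hq0 : 0 ≤ q := by positivity
  obtain ⟨M, hMdef⟩ : ∃ M : ℝ,
      M = (q * (K + ‖Gclm g 0‖)) ^ 2 / 2 + q * (lam + b * m ^ 2) := ⟨_, rfl⟩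
  have hM0 : 0 ≤ M := by rw [hMdef]; positivity
  set κ : ℝ := 2 * m * M + q * (b * m ^ 2) with hκdef
  have hκ0 : 0 ≤ κ := by positivity
  set r : ℕ := ⌈4 * c * p⌉₊ with hrdef
  obtain ⟨C₃, hC₃⟩ := exists_natCast_rpow_mul_exp_neg_le (p + 1) (b := 1 / (4 * T)) (by positivity)
  set C₁ : ℝ≥0∞ := ∫⁻ x, ENNReal.ofReal ((lam + ‖x‖) ^ r) ∂μξ with hC₁def
  have hC₁ : C₁ ≠ ∞ := lintegral_add_norm_pow_ne_top hlam r (hμξmom r)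
  set N₀ : ℕ := ⌈4 * M * T⌉₊ with hN₀def
  set B : ℝ≥0∞ := (N₀ : ℝ≥0∞) ^ p + (C₁ + ENNReal.ofReal (rexp (q * lam + κ * T))
    + ENNReal.ofReal (C₃ * rexp (m / 2))) with hBdef
  have hB : B ≠ ∞ := by
    have : (N₀ : ℝ≥0∞) ^ p ≠ ∞ :=
      ENNReal.rpow_ne_top_of_nonneg (by linarith) (ENNReal.natCast_ne_top _)
    finiteness
  refine ⟨B.toReal, ?_⟩
  intro N hN Ω mΩ P hP ξ ΔW Y hξ hW hξlaw hWlaw hindep hξW hY0 hY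
  rw [ENNReal.ofReal_toReal hB]
  by_cases hNN : N < N₀
  · calc _ ≤ (N : ℝ≥0∞) ^ p * 1 := by gcongr; exact prob_le_one
      _ ≤ (N₀ : ℝ≥0∞) ^ p := by
        rw [mul_one]
        exact ENNReal.rpow_le_rpow (by exact_mod_cast hNN.le) (by linarith)
      _ ≤ B := le_self_add
  have hNR : (0 : ℝ) < N := by exact_mod_cast hN
  have hN1 : (1 : ℝ) ≤ N := by exact_mod_cast hN
  have hh : 0 < T / N := by positivity
  set h : ℝ := T / N with hhdef
  clear_value h
  have hsmall : 4 * M * h ≤ 1 := by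
    rw [hhdef, ← mul_div_assoc, div_le_one hNR]
    exact (Nat.le_ceil _).trans (by exact_mod_cast not_lt.1 hNN)
  have hlaw : ∀ k, Measure.map (ΔW k) P = gaussianVec m h := hWlaw
  set S : ℕ → ℕ → Ω → ℝ := fun u n ω => ∑ k ∈ Finset.Ico u n,
    (lam * ‖ΔW k ω‖ ^ 2 + alph h g (Y k ω) (ΔW k ω)) with hSdef
  have hYm : ∀ k, Measurable (Y k) :=
    measurable_milstep_recursion hphc hpsc hgc hLc hξ hW hY0 hY
  have hSm : ∀ u n, Measurable (S u n) := by
    intro u n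
    refine Finset.measurable_fun_sum _ fun k _ => ?_
    have hsq : Measurable fun ω => lam * ‖ΔW k ω‖ ^ 2 := ((hW k).norm.pow_const 2).const_mul lam
    have hal := (measurable_alph h hgc hLc).comp ((hYm k).prodMk (hW k))
    exact hsq.add hal
  have hSexp : ∀ u n, n ≤ N →
      ∫⁻ ω, ENNReal.ofReal (rexp (q * S u n ω)) ∂P ≤ ENNReal.ofReal (rexp (κ * T)) := by
    intro u n hn
    have hrec := lintegral_exp_sum_recursion_le (P := P) (κ := κ * h)
      (st := fun z => milstep h ph ps g z.1 z.2)
      (G := fun z => q * (lam * ‖z.2‖ ^ 2 + alph h g z.1 z.2)) (by positivity) hξ hW hindep hξW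
      (measurable_milstep h hphc hpsc hgc hLc)
      (((measurable_snd.norm.pow_const 2).const_mul lam).add
        (measurable_alph h hgc hLc) |>.const_mul q) hY0 hY (by
        intro k y
        rw [hlaw]
        exact lintegral_exp_alph_le hh hK0 hKb hlam hq0 hgLip hLgLip hL0 hMdef hsmall y) u n
    simp only [← Finset.mul_sum] at hrec
    refine hrec.trans (ENNReal.ofReal_le_ofReal (Real.exp_le_exp.2 ?_))
    rw [mul_assoc]
    gcongr
    rw [hhdef, div_mul_eq_mul_div, div_le_iff₀ hNR]
    gcongr
  set a : ℝ := (N : ℝ) ^ ((1 : ℝ) / (4 * c)) with hadef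
  have ha0 : 0 < a := by positivity
  have haa : (N : ℝ) ^ ((1 : ℝ) / (2 * c)) = a * a := by
    rw [hadef, ← Real.rpow_add hNR]
    congr 1
    field_simp
    norm_num
  set E₁ : Set Ω := {ω | a < lam + ‖ξ ω‖} with hE₁
  set E₂ : ℕ → ℕ → Set Ω := fun n u => {ω | a < rexp (lam + S u n ω)} with hE₂
  set E₃ : ℕ → Set Ω := fun k => {ω | 1 < ‖ΔW k ω‖} with hE₃
  have hsub : {ω | ¬ ((∀ k < N, Dproc lam ‖ξ ω‖ (fun l => ‖ΔW l ω‖ ^ 2)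
          (fun l => alph h g (Y l ω) (ΔW l ω)) k ≤ (N : ℝ) ^ ((1 : ℝ) / (2 * c)))
        ∧ (∀ k < N, ‖ΔW k ω‖ ≤ 1))}
      ⊆ E₁ ∪ (⋃ n ∈ Finset.range N, ⋃ u ∈ Finset.range N, E₂ n u)
        ∪ ⋃ k ∈ Finset.range N, E₃ k := by
    intro ω hω
    rw [Set.mem_ofPred_eq, not_and_or] at hω
    rcases hω with hω | hω <;> push Not at hω <;> obtain ⟨n, hn, hω⟩ := hω
    · rw [haa] at hω
      rcases exists_lt_of_sq_lt_Dproc ha0.le hω with h1 | ⟨u, hu, h2⟩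
      · exact Or.inl (Or.inl h1)
      · refine Or.inl (Or.inr ?_)
        simp only [Set.mem_iUnion, Finset.mem_range]
        exact ⟨n, hn, u, by omega, h2⟩
    · refine Or.inr ?_
      simp only [Set.mem_iUnion, Finset.mem_range]
      exact ⟨n, hn, hω⟩
  have hP₁ : (N : ℝ≥0∞) ^ p * P E₁ ≤ C₁ := by
    have hmap : C₁ = ∫⁻ ω, ENNReal.ofReal ((lam + ‖ξ ω‖) ^ r) ∂P := by
      rw [hC₁def, ← hξlaw, lintegral_map (by fun_prop) hξ]
    rw [hmap, natCast_rpow_eq_ofReal_rpow hN]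
    refine ofReal_mul_measure_le_lintegral (by fun_prop) fun ω hω => ?_
    calc (N : ℝ) ^ p ≤ (N : ℝ) ^ (1 / (4 * c) * (r : ℝ)) := by
          refine Real.rpow_le_rpow_of_exponent_le hN1 ?_
          rw [one_div, le_inv_mul_iff₀ (by positivity)]
          exact Nat.le_ceil _
      _ = a ^ r := by rw [Real.rpow_mul hNR.le, Real.rpow_natCast]
      _ ≤ (lam + ‖ξ ω‖) ^ r := pow_le_pow_left₀ ha0.le (le_of_lt hω) r
  have hP₂ : ∀ n < N, ∀ u, (N : ℝ≥0∞) ^ (p + 1 + 1) * P (E₂ n u)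
      ≤ ENNReal.ofReal (rexp (q * lam + κ * T)) := by
    intro n hn u
    rw [natCast_rpow_eq_ofReal_rpow hN]
    have hmarkov : ENNReal.ofReal ((N : ℝ) ^ (p + 1 + 1)) * P (E₂ n u)
        ≤ ∫⁻ ω, ENNReal.ofReal (rexp (q * lam) * rexp (q * S u n ω)) ∂P := by
      have := hSm u n
      refine ofReal_mul_measure_le_lintegral (by fun_prop) fun ω hω => ?_
      calc (N : ℝ) ^ (p + 1 + 1) = a ^ q := by
            rw [hadef, ← Real.rpow_mul hNR.le, hqdef]
            congr 1
            field_simp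
            ring
        _ ≤ rexp (lam + S u n ω) ^ q := Real.rpow_le_rpow ha0.le (le_of_lt hω) hq0
        _ = rexp (q * lam) * rexp (q * S u n ω) := by
            rw [← Real.exp_mul, ← Real.exp_add]
            ring_nf
    refine hmarkov.trans ?_
    simp_rw [ENNReal.ofReal_mul (Real.exp_pos _).le]
    have := hSm u n
    rw [lintegral_const_mul _ (by fun_prop), Real.exp_add, ENNReal.ofReal_mul (Real.exp_pos _).le]
    gcongr
    exact hSexp u n hn.le
  have hP₃ : ∀ k, (N : ℝ≥0∞) ^ (p + 1) * P (E₃ k) ≤ ENNReal.ofReal (C₃ * rexp (m / 2)) := by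
    intro k
    set s : ℝ := N / (4 * T) with hsdef
    have hs0 : 0 ≤ s := by positivity
    have hsh : s * h = 1 / 4 := by
      rw [hsdef, hhdef]
      field_simp
    have hmarkov : ENNReal.ofReal (rexp s) * P (E₃ k) ≤ ENNReal.ofReal (rexp (m / 2)) := by
      calc _ ≤ ∫⁻ ω, ENNReal.ofReal (rexp (s * ‖ΔW k ω‖ ^ 2)) ∂P := by
            have := hW k
            refine ofReal_mul_measure_le_lintegral (by fun_prop) fun ω hω => ?_
            have h1 : (1 : ℝ) ≤ ‖ΔW k ω‖ ^ 2 := one_le_pow₀ (le_of_lt hω)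
            exact Real.exp_le_exp.2 (by nlinarith)
        _ = ∫⁻ w, ENNReal.ofReal (rexp (s * ‖w‖ ^ 2)) ∂(gaussianVec m h) := by
            rw [← hlaw k, lintegral_map (by fun_prop) (hW k)]
        _ ≤ ENNReal.ofReal (rexp (2 * m * s * h)) :=
            lintegral_exp_sq_gaussianVec_le m hh hs0 (by linarith)
        _ = ENNReal.ofReal (rexp (m / 2)) := by
            rw [mul_assoc, hsh]
            ring_nf
    have hsplit : (N : ℝ) ^ (p + 1) = (N : ℝ) ^ (p + 1) * rexp (-(1 / (4 * T)) * N) * rexp s := by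
      rw [mul_assoc, ← Real.exp_add,
        show -(1 / (4 * T)) * N + s = 0 by rw [hsdef]; ring, Real.exp_zero, mul_one]
    have hC₃0 : 0 ≤ C₃ := le_trans (by positivity) (hC₃ N)
    rw [natCast_rpow_eq_ofReal_rpow hN, hsplit, ENNReal.ofReal_mul (by positivity), mul_assoc,
      ENNReal.ofReal_mul hC₃0]
    exact mul_le_mul' (ENNReal.ofReal_le_ofReal (hC₃ N)) hmarkov
  calc _ ≤ (N : ℝ≥0∞) ^ p * (P E₁ + ∑ n ∈ Finset.range N, ∑ u ∈ Finset.range N, P (E₂ n u)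
        + ∑ k ∈ Finset.range N, P (E₃ k)) := by
        gcongr
        refine (measure_mono hsub).trans ((measure_union_le _ _).trans ?_)
        refine add_le_add ((measure_union_le _ _).trans (add_le_add le_rfl ?_))
          (measure_biUnion_finset_le _ _)
        exact (measure_biUnion_finset_le _ _).trans
          (Finset.sum_le_sum fun n _ => measure_biUnion_finset_le _ _)
    _ ≤ C₁ + ENNReal.ofReal (rexp (q * lam + κ * T)) + ENNReal.ofReal (C₃ * rexp (m / 2)) := by
        rw [mul_add, mul_add]
        refine add_le_add (add_le_add hP₁ ?_) ?_
        · exact natCast_rpow_mul_sum_le hN fun n hn => natCast_rpow_mul_sum_le hN fun u _ =>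
            hP₂ n (Finset.mem_range.1 hn) u
        · exact natCast_rpow_mul_sum_le hN fun k _ => hP₃ k
    _ ≤ B := le_add_self

end
end
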